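/- Let n ≥ 2 and let a = (a_0, a_1, ..., a_{n-1}) ∈ ℝ^n be regarded as an n×1 matrix. The map ℝ^{n-1} → ℝ^n given by x = (x_1,...,x_{n-1}) ↦ (x_1,...,x_{n-1}, a_0 + a_1 x_1 + ... + a_{n-1} x_{n-1}) (parametrizing an affine hyperplane of ℝ^n) is extremal if and only if a ∉ W_n^+(n,1), that is, if and only if for every v > n there are only finitely many q ∈ ℤ for which ‖aq + p‖ ≤ |q|^{-v} for some p ∈ ℤ^n. -/

import Mathlib

open MeasureTheory

/-- `y ∈ W_v(1,n)`: infinitely many `q ∈ ℤ^n` with `|y·q + p| ≤ ‖q‖^{-v}` for some `p ∈ ℤ`. -/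
def InW {n : ℕ} (y : Fin n → ℝ) (v : ℝ) : Prop :=
  {q : Fin n → ℤ | ∃ p : ℤ,
    |(∑ i, y i * (q i : ℝ)) + (p : ℝ)| ≤
      ‖(fun i => (q i : ℝ) : Fin n → ℝ)‖ ^ (-v)}.Infinite

/-- `y` is very well approximable. -/
def IsVWA {n : ℕ} (y : Fin n → ℝ) : Prop :=
  ∃ v : ℝ, (n : ℝ) < v ∧ InW y v

/-- `f` is extremal on `U`: `f x` is not VWA for a.e. `x ∈ U`. -/
def IsExtremal {α : Type*} [MeasureSpace α] {n : ℕ} (U : Set α) (f : α → Fin n → ℝ) : Prop :=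
  volume {x ∈ U | IsVWA (f x)} = 0

theorem summable_norm_intCast_rpow_neg {n : ℕ} {v : ℝ} (hv : (n : ℝ) < v) :
    Summable fun Q : Fin n → ℤ => ‖(fun i => (Q i : ℝ) : Fin n → ℝ)‖ ^ (-v) := by
  obtain ⟨L, hL⟩ : ∃ L, L = Submodule.span ℤ (Set.range (Pi.basisFun ℝ (Fin n))) := ⟨_, rfl⟩
  have hdisc : DiscreteTopology L := by rw [hL]; infer_instance
  have hlat : IsZLattice ℝ L := by subst hL; infer_instance
  have hrank : Module.finrank ℤ L = n := by
    rw [ZLattice.rank ℝ L, Module.finrank_fin_fun]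
  have hs := ZLattice.summable_norm_rpow L (-v) (by rw [hrank]; linarith)
  have hmem (Q : Fin n → ℤ) : (fun i => (Q i : ℝ) : Fin n → ℝ) ∈ L := by
    rw [hL, Module.Basis.mem_span_iff_repr_mem]
    intro i
    exact ⟨Q i, by rw [Pi.basisFun_repr]; rfl⟩
  have hinj : Function.Injective fun Q : Fin n → ℤ => (⟨_, hmem Q⟩ : L) := by
    intro Q Q' h
    have h' : (fun i => (Q i : ℝ)) = fun i => (Q' i : ℝ) := congrArg Subtype.val h
    funext i
    have h'' : (Q i : ℝ) = Q' i := congrFun h' i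
    exact Int.cast_injective h''
  refine (hs.comp_injective hinj).congr fun Q => ?_
  rw [Function.comp_apply, Submodule.coe_norm]

theorem summable_rpow_neg_div_of_gap {d : ℕ → ℝ} {c w v : ℝ} (hc : 0 < c) (hw : 1 < w)
    (hwv : w < v) (hd : ∀ k, 1 ≤ k → c ≤ d k * (k : ℝ) ^ w) (hd1 : ∀ k, d k ≤ 1)
    (hsub : ∀ k l, k ≤ l → d (l - k) ≤ d k + d l) :
    Summable fun k : ℕ => (k : ℝ) ^ (-v) / d k := by
  have hpos : ∀ k, 1 ≤ k → 0 < d k := by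
    intro k hk
    have : (0 : ℝ) < (k : ℝ) ^ w := by positivity
    by_contra h
    nlinarith [hd k hk]
  have hlev : ∀ k, 1 ≤ k → ∃ j : ℕ, (1 / 2 : ℝ) ^ (j + 1) < d k ∧ d k ≤ (1 / 2 : ℝ) ^ j :=
    fun k hk => exists_nat_pow_near_of_lt_one (hpos k hk) (hd1 k) (by norm_num) (by norm_num)
  choose! J hJ1 hJ2 using hlev
  let g : ℕ → ℝ := fun j => (c / 2 * 2 ^ j) ^ (1 / w)
  have hw0 : 0 < w := by linarith
  have hg : ∀ j, 0 < g j := fun j => by positivity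
  have hgw : ∀ j, g j ^ w = c / 2 * 2 ^ j := fun j => by
    simp only [g]
    rw [← Real.rpow_mul (by positivity), one_div_mul_cancel hw0.ne', Real.rpow_one]
  have hgle : ∀ j k, 1 ≤ k → d k ≤ 2 * (1 / 2) ^ j → g j ≤ k := by
    intro j k hk h
    rw [← Real.rpow_le_rpow_iff (hg j).le (by positivity) hw0, hgw]
    have h1 := hd k hk
    have h2 : (0 : ℝ) < (k : ℝ) ^ w := by positivity
    have h3 : c ≤ 2 * (1 / 2) ^ j * (k : ℝ) ^ w := h1.trans (by gcongr)
    have h4 : (2 : ℝ) ^ j * (1 / 2) ^ j = 1 := by rw [← mul_pow]; norm_num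
    have h5 : (0 : ℝ) < 2 ^ j := by positivity
    calc c / 2 * 2 ^ j ≤ (2 * (1 / 2) ^ j * (k : ℝ) ^ w) / 2 * 2 ^ j := by gcongr
      _ = (2 ^ j * (1 / 2) ^ j) * (k : ℝ) ^ w := by ring
      _ = _ := by rw [h4, one_mul]
  let r : ℝ := 2 * (2 : ℝ) ^ (-(v / w))
  let F : ℕ × ℕ → ℝ := fun p => (2 * (c / 2) ^ (-(v / w)) * r ^ p.1) * (p.2 : ℝ) ^ (-v)
  have hr1 : r < 1 := by
    have : (2 : ℝ) ^ (-(v / w)) < 2 ^ (-1 : ℝ) := by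
      apply Real.rpow_lt_rpow_of_exponent_lt (by norm_num)
      have : 1 < v / w := by rw [lt_div_iff₀ hw0]; linarith
      exact neg_lt_neg this
    rw [Real.rpow_neg_one] at this
    simp only [r]; linarith
  have hF : Summable F := by
    refine Summable.mul_of_nonneg (f := fun j : ℕ => 2 * (c / 2) ^ (-(v / w)) * r ^ j)
      (g := fun t : ℕ => (t : ℝ) ^ (-v)) ?_ ?_ ?_ ?_
    · exact (summable_geometric_of_lt_one (by positivity) hr1).mul_left _
    · exact Real.summable_nat_rpow.mpr (by linarith)
    · intro j; dsimp; positivity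
    · intro j; dsimp; positivity
  let φ : ℕ → ℕ × ℕ := fun k => (J (k + 1), ⌊((k + 1 : ℕ) : ℝ) / g (J (k + 1))⌋₊)
  have key : ∀ k l : ℕ, k < l → φ k ≠ φ l := by
    intro k l hkl h
    obtain ⟨h1, h2⟩ := Prod.ext_iff.mp h
    simp only [φ] at h1 h2
    rw [← h1] at h2
    have hgap := hgle (J (k + 1)) ((l + 1) - (k + 1)) (by omega) (by
      have a2 := hJ2 (l + 1) (by omega)
      rw [← h1] at a2
      rw [two_mul]
      exact (hsub (k + 1) (l + 1) (by omega)).trans (add_le_add (hJ2 (k + 1) (by omega)) a2))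
    have hG := hg (J (k + 1))
    set G := g (J (k + 1))
    have e1 := Nat.floor_le (show 0 ≤ ((k + 1 : ℕ) : ℝ) / G by positivity)
    have e2 := Nat.lt_floor_add_one (((l + 1 : ℕ) : ℝ) / G)
    rw [← h2] at e2
    rw [Nat.cast_sub (by omega)] at hgap
    have : ((l + 1 : ℕ) : ℝ) / G - ((k + 1 : ℕ) : ℝ) / G < 1 := by linarith
    rw [← sub_div, div_lt_one hG] at this
    linarith
  have hφ : Function.Injective φ := by
    intro k l h
    rcases lt_trichotomy k l with h1 | h1 | h1
    · exact absurd h (key _ _ h1)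
    · exact h1
    · exact absurd h.symm (key _ _ h1)
  rw [← summable_nat_add_iff 1]
  refine Summable.of_nonneg_of_le (fun k => ?_) (fun k => ?_) (hF.comp_injective hφ)
  · have := hpos (k + 1) (by omega)
    positivity
  · have hk : 1 ≤ k + 1 := by omega
    simp only [Function.comp, F, φ]
    have hG := hg (J (k + 1))
    have hGw := hgw (J (k + 1))
    have a0 := hpos _ hk
    have a1 := hJ1 _ hk
    have a2 := hgle _ _ hk ((hJ2 _ hk).trans (le_mul_of_one_le_left (by positivity) one_le_two))
    set j := J (k + 1)
    set G := g j
    set t := ⌊((k + 1 : ℕ) : ℝ) / G⌋₊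
    have ht : 1 ≤ t := Nat.one_le_floor_iff _ |>.mpr ((one_le_div hG).mpr a2)
    have ht' : (t : ℝ) * G ≤ ((k + 1 : ℕ) : ℝ) := by
      rw [← le_div_iff₀ hG]; exact Nat.floor_le (by positivity)
    have hGv : G ^ (-v) = (c / 2) ^ (-(v / w)) * ((2 : ℝ) ^ (-(v / w))) ^ j := by
      have : -v = w * (-(v / w)) := by field_simp
      rw [this, Real.rpow_mul hG.le, hGw, Real.mul_rpow (by positivity) (by positivity),
        ← Real.rpow_natCast, ← Real.rpow_natCast, ← Real.rpow_mul (by norm_num),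
        ← Real.rpow_mul (by norm_num), mul_comm (j : ℝ)]
    have hb : ((k + 1 : ℕ) : ℝ) ^ (-v) ≤ (t : ℝ) ^ (-v) * G ^ (-v) := by
      rw [← Real.mul_rpow (by positivity) hG.le]
      exact Real.rpow_le_rpow_of_nonpos (by positivity) ht' (by linarith)
    have hdi : (d (k + 1))⁻¹ ≤ 2 * 2 ^ j := by
      rw [inv_le_comm₀ a0 (by positivity)]
      refine le_trans (le_of_eq ?_) a1.le
      rw [pow_succ, one_div, inv_pow, mul_inv, mul_comm]
    rw [div_eq_mul_inv]
    calc _ ≤ ((t : ℝ) ^ (-v) * G ^ (-v)) * (2 * 2 ^ j) := by gcongr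
      _ = _ := by rw [hGv]; simp only [r]; rw [mul_pow]; ring

theorem volume_slab_mul_le {m : ℕ} {R δ : ℝ} (hR : 0 ≤ R) (hδ : 0 ≤ δ) (c₀ : ℝ) (c : Fin m → ℝ)
    (i : Fin m) :
    volume {x : Fin m → ℝ | ‖x‖ ≤ R ∧ |c₀ + ∑ j, c j * x j| ≤ δ} * ENNReal.ofReal |c i| ≤
      ENNReal.ofReal ((2 * R) ^ (m - 1) * (2 * δ)) := by
  let M : Matrix (Fin m) (Fin m) ℝ := (1 : Matrix (Fin m) (Fin m) ℝ).updateRow i c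
  have hdet : M.det = c i := by
    have := Matrix.cramer_transpose_apply (1 : Matrix (Fin m) (Fin m) ℝ) c i
    rw [← this, Matrix.transpose_one, Matrix.cramer_one]; rfl
  rw [mul_comm, ← hdet, ← LinearMap.det_toLin', ← Measure.addHaar_image_linearMap volume]
  let b : Fin m → ℝ := Function.update (fun _ => R) i δ
  let z : Fin m → ℝ := Function.update 0 i (-c₀)
  have hsub : (Matrix.toLin' M) '' {x : Fin m → ℝ | ‖x‖ ≤ R ∧ |c₀ + ∑ j, c j * x j| ≤ δ} ⊆
      Set.Icc (z - b) (z + b) := by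
    rintro _ ⟨x, ⟨hx, hs⟩, rfl⟩
    rw [Set.mem_Icc, Pi.le_def, Pi.le_def, ← forall_and]
    intro k
    rw [Matrix.toLin'_apply]
    by_cases hk : k = i
    · subst hk
      have : M.mulVec x k = ∑ j, c j * x j := by simp [M, Matrix.mulVec, dotProduct]
      rw [this]
      rw [abs_le] at hs
      simp [z, b]
      constructor <;> linarith
    · have : M.mulVec x k = x k := by
        simp [M, Matrix.mulVec, dotProduct, hk, Matrix.one_apply]
      rw [this]
      have := abs_le.mp ((norm_le_pi_norm x k).trans hx)
      simp [z, b, hk]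
      constructor <;> linarith
  refine (measure_mono hsub).trans ?_
  rw [Real.volume_Icc_pi, ← ENNReal.ofReal_prod_of_nonneg]
  · apply ENNReal.ofReal_le_ofReal
    rw [← Finset.mul_prod_erase Finset.univ _ (Finset.mem_univ i)]
    apply le_of_eq
    have : ∏ x ∈ Finset.univ.erase i, ((z + b) x - (z - b) x) = (2 * R) ^ (m - 1) := by
      rw [Finset.prod_congr rfl (g := fun _ => 2 * R)]
      · simp
      · intro k hk
        simp [z, b, Finset.ne_of_mem_erase hk]; ring
    rw [this]
    simp [z, b]; ring
  · intro k _
    by_cases hk : k = i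
    · subst hk; simp [b]; linarith
    · simp [b, hk]; linarith

theorem abs_sum_mul_le {m : ℕ} (c x : Fin m → ℝ) : |∑ j, c j * x j| ≤ m * ‖c‖ * ‖x‖ := by
  refine (Finset.abs_sum_le_sum_abs _ _).trans ?_
  calc ∑ j, |c j * x j| ≤ ∑ _j : Fin m, ‖c‖ * ‖x‖ := by
        refine Finset.sum_le_sum fun j _ => ?_
        rw [abs_mul]
        exact mul_le_mul (norm_le_pi_norm c j) (norm_le_pi_norm x j) (abs_nonneg _) (norm_nonneg _)
    _ = _ := by simp [mul_assoc]

theorem volume_slab_le {m : ℕ} (hm : 1 ≤ m) {R δ N : ℝ} (hR : 1 ≤ R) (hδ : 0 ≤ δ) (hN : 0 < N)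
    (c₀ : ℝ) (c : Fin m → ℝ) (hNc : N ≤ max |c₀| ‖c‖) :
    volume {x : Fin m → ℝ | ‖x‖ ≤ R ∧ |c₀ + ∑ j, c j * x j| ≤ δ} ≤
      ENNReal.ofReal (2 * m * (2 * R) ^ m * (δ / N)) := by
  have hm' : (1 : ℝ) ≤ m := by exact_mod_cast hm
  rcases lt_or_ge (N / 2) δ with h | h
  · have hsub : {x : Fin m → ℝ | ‖x‖ ≤ R ∧ |c₀ + ∑ j, c j * x j| ≤ δ} ⊆ Metric.closedBall 0 R := by
      intro x hx
      simpa using hx.1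
    refine (measure_mono hsub).trans ?_
    rw [Real.volume_pi_closedBall _ (by linarith)]
    apply ENNReal.ofReal_le_ofReal
    have h1 : 1 ≤ 2 * (δ / N) := by
      rw [← mul_div_assoc, le_div_iff₀ hN]; linarith
    have h2 : 1 * 1 ≤ m * (2 * (δ / N)) := mul_le_mul hm' h1 zero_le_one (by linarith)
    have h3 : 0 < (2 * R) ^ m := by positivity
    simp only [Fintype.card_fin]
    calc (2 * R) ^ m = (2 * R) ^ m * (1 * 1) := by ring
      _ ≤ (2 * R) ^ m * (m * (2 * (δ / N))) := by gcongr
      _ = _ := by ring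
  · rcases Set.eq_empty_or_nonempty {x : Fin m → ℝ | ‖x‖ ≤ R ∧ |c₀ + ∑ j, c j * x j| ≤ δ}
      with he | ⟨x, hx, hxs⟩
    · rw [he]; simp
    have h0 : |c₀| ≤ m * R * ‖c‖ + δ := by
      have h1 : |c₀| ≤ |c₀ + ∑ j, c j * x j| + |∑ j, c j * x j| := by
        have := abs_sub (c₀ + ∑ j, c j * x j) (∑ j, c j * x j)
        rwa [add_sub_cancel_right] at this
      have h2 := abs_sum_mul_le c x
      have h3 : m * ‖c‖ * ‖x‖ ≤ m * ‖c‖ * R := by gcongr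
      linarith [h3.trans_eq (show m * ‖c‖ * R = m * R * ‖c‖ by ring)]
    have hmR : 1 ≤ m * R := by nlinarith
    have hc : N ≤ 2 * (m * R) * ‖c‖ := by
      rcases le_max_iff.mp hNc with h1 | h1
      · linarith
      · nlinarith [norm_nonneg c]
    have hcpos : 0 < ‖c‖ := by
      by_contra hcon
      have : ‖c‖ = 0 := le_antisymm (not_lt.mp hcon) (norm_nonneg c)
      rw [this] at hc
      linarith
    have : Nonempty (Fin m) := ⟨⟨0, hm⟩⟩
    obtain ⟨i, hi⟩ := Finite.exists_max fun j => ‖c j‖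
    have hci : |c i| = ‖c‖ :=
      le_antisymm (norm_le_pi_norm c i) ((pi_norm_le_iff_of_nonneg (norm_nonneg _)).mpr hi)
    have hs := volume_slab_mul_le (by linarith) hδ c₀ c i (R := R)
    rw [hci] at hs
    rw [← ENNReal.le_div_iff_mul_le (by left; simpa using hcpos) (by left; simp),
      ← ENNReal.ofReal_div_of_pos hcpos] at hs
    refine hs.trans (ENNReal.ofReal_le_ofReal ?_)
    rw [div_le_iff₀ hcpos]
    obtain ⟨k, rfl⟩ : ∃ k, m = k + 1 := ⟨m - 1, by omega⟩
    rw [Nat.add_sub_cancel, pow_succ]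
    have h5 : δ ≤ δ / N * (2 * (((k + 1 : ℕ) : ℝ) * R) * ‖c‖) := by
      rw [div_mul_eq_mul_div, le_div_iff₀ hN]
      gcongr
    calc (2 * R) ^ k * (2 * δ)
        ≤ (2 * R) ^ k * (2 * (δ / N * (2 * (((k + 1 : ℕ) : ℝ) * R) * ‖c‖))) := by gcongr
      _ = _ := by ring

/-- Sup-norm distance from `q a` to the integer lattice. -/
noncomputable def distInt {n : ℕ} (a : Fin n → ℝ) (q : ℤ) : ℝ :=
  ‖(fun i => a i * (q : ℝ) - (round (a i * (q : ℝ)) : ℝ) : Fin n → ℝ)‖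

theorem distInt_le {n : ℕ} (a : Fin n → ℝ) (q : ℤ) (p : Fin n → ℤ) :
    distInt a q ≤ ‖(fun i => a i * (q : ℝ) + (p i : ℝ) : Fin n → ℝ)‖ := by
  refine (pi_norm_le_iff_of_nonneg (norm_nonneg _)).mpr fun i => ?_
  refine le_trans ?_ (norm_le_pi_norm _ i)
  have := round_le (a i * (q : ℝ)) (-p i)
  simpa using this

theorem distInt_nonneg {n : ℕ} (a : Fin n → ℝ) (q : ℤ) : 0 ≤ distInt a q := norm_nonneg _

theorem distInt_le_one {n : ℕ} (a : Fin n → ℝ) (q : ℤ) : distInt a q ≤ 1 := by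
  refine (pi_norm_le_iff_of_nonneg zero_le_one).mpr fun i => ?_
  exact (abs_sub_round _).trans (by norm_num)

theorem distInt_sub_le {n : ℕ} (a : Fin n → ℝ) (k l : ℤ) :
    distInt a (l - k) ≤ distInt a k + distInt a l := by
  refine (distInt_le a (l - k) fun i => round (a i * k) - round (a i * l)).trans ?_
  rw [add_comm, distInt, distInt]
  refine le_trans (le_of_eq ?_) (norm_sub_le _ _)
  congr 1
  funext i
  simp only [Pi.sub_apply]
  push_cast
  ring

theorem distInt_neg {n : ℕ} (a : Fin n → ℝ) (q : ℤ) : distInt a (-q) = distInt a q := by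
  have h0 : distInt a 0 = 0 := by simp [distInt]; rfl
  have h (q : ℤ) : distInt a (-q) ≤ distInt a q := by
    simpa [h0] using distInt_sub_le a q 0
  exact le_antisymm (h q) (by simpa using h (-q))

theorem exists_pos_le_distInt_mul_rpow {n : ℕ} (a : Fin n → ℝ) {w : ℝ}
    (hfin : {q : ℤ | ∃ p : Fin n → ℤ,
        ‖(fun i => a i * (q : ℝ) + (p i : ℝ) : Fin n → ℝ)‖ ≤ |(q : ℝ)| ^ (-w)}.Finite) :
    ∃ c : ℝ, 0 < c ∧ ∀ q : ℤ, q ≠ 0 → c ≤ distInt a q * |(q : ℝ)| ^ w := by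
  have hpos : ∀ q : ℤ, q ≠ 0 → 0 < distInt a q := by
    intro q hq
    by_contra hcon
    have h0 : distInt a q = 0 := le_antisymm (not_lt.mp hcon) (distInt_nonneg a q)
    rw [distInt, norm_eq_zero] at h0
    refine (Set.infinite_of_injective_forall_mem (f := fun k : ℤ => k * q)
      (fun k l h => mul_right_cancel₀ hq h) fun k => ?_) hfin
    refine ⟨fun i => -(k * round (a i * q)), ?_⟩
    have : (fun i => a i * ((k * q : ℤ) : ℝ) + ((-(k * round (a i * q)) : ℤ) : ℝ)) = 0 := by
      funext i
      have := congrFun h0 i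
      simp only [Pi.zero_apply] at this ⊢
      push_cast
      linear_combination (k : ℝ) * this
    rw [this, norm_zero]
    positivity
  have hqpos : ∀ q : ℤ, q ≠ 0 → 0 < |(q : ℝ)| := fun q hq => by simpa using hq
  have hT : ∃ c : ℝ, 0 < c ∧ ∀ q ∈ hfin.toFinset.erase 0, c ≤ distInt a q * |(q : ℝ)| ^ w := by
    rcases (hfin.toFinset.erase 0).eq_empty_or_nonempty with h | h
    · exact ⟨1, one_pos, by simp [h]⟩
    · obtain ⟨q₀, hq₀, hmin⟩ := Finset.exists_min_image _
        (fun q : ℤ => distInt a q * |(q : ℝ)| ^ w) h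
      have hq := Finset.ne_of_mem_erase hq₀
      exact ⟨_, mul_pos (hpos _ hq) (Real.rpow_pos_of_pos (hqpos _ hq) _), hmin⟩
  obtain ⟨c, hc, hcT⟩ := hT
  refine ⟨min c 1, lt_min hc one_pos, fun q hq => ?_⟩
  by_cases hmem : q ∈ hfin.toFinset
  · exact (min_le_left _ _).trans (hcT q (Finset.mem_erase.mpr ⟨hq, hmem⟩))
  · refine (min_le_right _ _).trans ?_
    rw [Set.Finite.mem_toFinset, Set.mem_ofPred_eq] at hmem
    push Not at hmem
    have h1 := hmem fun i => -round (a i * q)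
    have h2 : |(q : ℝ)| ^ (-w) < distInt a q := by
      simpa [distInt, sub_eq_add_neg] using h1
    rw [Real.rpow_neg (abs_nonneg _)] at h2
    have h3 := Real.rpow_pos_of_pos (hqpos q hq) w
    rw [inv_lt_iff_one_lt_mul₀ h3] at h2
    linarith

theorem summable_rpow_neg_div_distInt {n : ℕ} (a : Fin n → ℝ) {c w v : ℝ} (hc : 0 < c)
    (hw : 1 < w) (hwv : w < v) (ha : ∀ q : ℤ, q ≠ 0 → c ≤ distInt a q * |(q : ℝ)| ^ w) :
    Summable fun q : ℤ => |(q : ℝ)| ^ (-v) / distInt a q := by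
  have h : Summable fun k : ℕ => (k : ℝ) ^ (-v) / distInt a k := by
    refine summable_rpow_neg_div_of_gap hc hw hwv (fun k hk => ?_) (fun k => distInt_le_one a k)
      fun k l hkl => ?_
    · simpa using ha k (by omega)
    · rw [Nat.cast_sub hkl]
      exact distInt_sub_le a k l
  refine Summable.of_nat_of_neg ?_ ?_
  · simpa using h
  · simpa [distInt_neg] using h

theorem sum_snoc_affine {m : ℕ} (a : Fin (m + 1) → ℝ) (x : Fin m → ℝ) (Q : Fin (m + 1) → ℤ)
    (p : ℤ) :
    (∑ i, (Fin.snoc x (a 0 + ∑ i : Fin m, a i.succ * x i) : Fin (m + 1) → ℝ) i * (Q i : ℝ)) + p =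
      (a 0 * Q (Fin.last m) + p) +
        ∑ i : Fin m, (a i.succ * Q (Fin.last m) + Q i.castSucc) * x i := by
  rw [Fin.sum_univ_castSucc]
  simp only [Fin.snoc_castSucc, Fin.snoc_last, add_mul, Finset.sum_add_distrib, Finset.sum_mul]
  have h1 : ∑ i : Fin m, a i.succ * x i * (Q (Fin.last m) : ℝ) =
      ∑ i : Fin m, a i.succ * (Q (Fin.last m) : ℝ) * x i :=
    Finset.sum_congr rfl fun i _ => by ring
  have h2 : ∑ i : Fin m, x i * (Q i.castSucc : ℝ) = ∑ i : Fin m, (Q i.castSucc : ℝ) * x i :=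
    Finset.sum_congr rfl fun i _ => by ring
  rw [h1, h2]
  ring

theorem one_le_norm_intCast {n : ℕ} {Q : Fin n → ℤ} (hQ : Q ≠ 0) :
    1 ≤ ‖(fun i => (Q i : ℝ) : Fin n → ℝ)‖ := by
  obtain ⟨i, hi⟩ := Function.ne_iff.mp hQ
  refine le_trans ?_ (norm_le_pi_norm _ i)
  rw [Real.norm_eq_abs]
  exact_mod_cast Int.one_le_abs hi

/-- The integer vector whose last entry is `q` and whose other entries are the negatives of the
nearest integers to `q a_1, …, q a_m`. -/
noncomputable def nearestVec {m : ℕ} (a : Fin (m + 1) → ℝ) (q : ℤ) : Fin (m + 1) → ℤ :=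
  Fin.snoc (fun i : Fin m => -round (a i.succ * (q : ℝ))) q

theorem nearestVec_last {m : ℕ} (a : Fin (m + 1) → ℝ) (q : ℤ) :
    nearestVec a q (Fin.last m) = q := by
  simp [nearestVec]

theorem eq_nearestVec {m : ℕ} (a : Fin (m + 1) → ℝ) (Q : Fin (m + 1) → ℤ)
    (h : ‖(fun i : Fin m => a i.succ * (Q (Fin.last m) : ℝ) + (Q i.castSucc : ℝ))‖ < 1 / 2) :
    Q = nearestVec a (Q (Fin.last m)) := by
  funext j
  induction j using Fin.lastCases with
  | last => rw [nearestVec_last]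
  | cast i =>
    simp only [nearestVec, Fin.snoc_castSucc]
    have h1 := (norm_le_pi_norm
      (fun i : Fin m => a i.succ * (Q (Fin.last m) : ℝ) + (Q i.castSucc : ℝ)) i).trans_lt h
    have h2 := abs_sub_round (a i.succ * (Q (Fin.last m) : ℝ))
    rw [Real.norm_eq_abs, abs_lt] at h1
    rw [abs_le] at h2
    have h3 : |((Q i.castSucc + round (a i.succ * (Q (Fin.last m) : ℝ)) : ℤ) : ℝ)| < 1 := by
      push_cast
      rw [abs_lt]
      constructor <;> linarith
    have h4 : |Q i.castSucc + round (a i.succ * (Q (Fin.last m) : ℝ))| < 1 := by exact_mod_cast h3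
    have := Int.abs_lt_one_iff.mp h4
    linarith

theorem volume_iUnion_slab_le {m : ℕ} (hm : 1 ≤ m) {R δ N : ℝ} (hR : 1 ≤ R) (hδ : 0 ≤ δ)
    (hδ1 : δ ≤ 1) (hN : 0 < N) (t : ℝ) (c : Fin m → ℝ) (hNc : ∀ p : ℤ, N ≤ max |t + p| ‖c‖) :
    volume {x : Fin m → ℝ | ‖x‖ ≤ R ∧ ∃ p : ℤ, |t + p + ∑ j, c j * x j| ≤ δ} ≤
      ENNReal.ofReal ((2 * m * R * ‖c‖ + 3) * (2 * m * (2 * R) ^ m * (δ / N))) := by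
  obtain ⟨L, hL⟩ : ∃ L, L = m * R * ‖c‖ + 1 := ⟨_, rfl⟩
  have hL0 : 0 ≤ L := by rw [hL]; positivity
  obtain ⟨S, hS⟩ : ∃ S : Finset ℤ, S = Finset.Icc ⌈-t - L⌉ ⌊-t + L⌋ := ⟨_, rfl⟩
  have hcard : (S.card : ℝ) ≤ 2 * L + 1 := by
    rw [hS, Int.card_Icc]
    have h1 := Int.floor_le (-t + L)
    have h2 := Int.le_ceil (-t - L)
    have h3 : ((⌊-t + L⌋ + 1 - ⌈-t - L⌉ : ℤ) : ℝ) ≤ 2 * L + 1 := by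
      push_cast
      linarith
    rcases le_total 0 (⌊-t + L⌋ + 1 - ⌈-t - L⌉) with h | h
    · have h4 : (((⌊-t + L⌋ + 1 - ⌈-t - L⌉).toNat : ℤ) : ℝ) ≤ 2 * L + 1 := by
        rwa [Int.toNat_of_nonneg h]
      exact_mod_cast h4
    · rw [Int.toNat_of_nonpos h]
      push_cast
      linarith
  have hsub : {x : Fin m → ℝ | ‖x‖ ≤ R ∧ ∃ p : ℤ, |t + p + ∑ j, c j * x j| ≤ δ} ⊆
      ⋃ p ∈ S, {x : Fin m → ℝ | ‖x‖ ≤ R ∧ |t + p + ∑ j, c j * x j| ≤ δ} := by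
    rintro x ⟨hx, p, hp⟩
    refine Set.mem_biUnion (x := p) ?_ ⟨hx, hp⟩
    have h2 := abs_sum_mul_le c x
    have h3 : m * ‖c‖ * ‖x‖ ≤ m * R * ‖c‖ := by
      calc m * ‖c‖ * ‖x‖ ≤ m * ‖c‖ * R := by gcongr
        _ = _ := by ring
    have h4 := abs_le.mp (h2.trans h3)
    have h5 := abs_le.mp hp
    rw [hS]
    simp only [Finset.coe_Icc, Set.mem_Icc, Int.ceil_le, Int.le_floor]
    constructor <;> linarith [h4.1, h4.2, h5.1, h5.2]
  have hK : 0 ≤ 2 * m * (2 * R) ^ m * (δ / N) := by positivity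
  calc _ ≤ ∑ p ∈ S, volume {x : Fin m → ℝ | ‖x‖ ≤ R ∧ |t + p + ∑ j, c j * x j| ≤ δ} :=
        (measure_mono hsub).trans (measure_biUnion_finset_le _ _)
    _ ≤ ∑ _p ∈ S, ENNReal.ofReal (2 * m * (2 * R) ^ m * (δ / N)) :=
        Finset.sum_le_sum fun p _ => volume_slab_le hm hR hδ hN _ c (hNc p)
    _ = ENNReal.ofReal (S.card * (2 * m * (2 * R) ^ m * (δ / N))) := by
        rw [Finset.sum_const, nsmul_eq_mul, ENNReal.ofReal_mul (p := (S.card : ℝ)) (by positivity),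
          ENNReal.ofReal_natCast]
    _ ≤ _ := by
        apply ENNReal.ofReal_le_ofReal
        refine mul_le_mul_of_nonneg_right (hcard.trans ?_) hK
        rw [hL]
        linarith

theorem volume_approx_le {m : ℕ} (hm : 1 ≤ m) {R v : ℝ} (hR : 1 ≤ R) (hv : 0 < v)
    (a : Fin (m + 1) → ℝ) (ha : ∀ q : ℤ, q ≠ 0 → 0 < distInt a q)
    (Q : Fin (m + 1) → ℤ) (hQ : Q ≠ 0) :
    volume {x : Fin m → ℝ | ‖x‖ ≤ R ∧ ∃ p : ℤ,
      |(∑ i, (Fin.snoc x (a 0 + ∑ i : Fin m, a i.succ * x i) : Fin (m + 1) → ℝ) i * (Q i : ℝ)) +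
        (p : ℝ)| ≤ ‖(fun i => (Q i : ℝ) : Fin (m + 1) → ℝ)‖ ^ (-v)} ≤
      ENNReal.ofReal ((2 * m * R + 6) * (2 * m * (2 * R) ^ m) *
        (‖(fun i => (Q i : ℝ) : Fin (m + 1) → ℝ)‖ ^ (-v) +
          if Q = nearestVec a (Q (Fin.last m)) then
            |(Q (Fin.last m) : ℝ)| ^ (-v) / distInt a (Q (Fin.last m)) else 0)) := by
  have hQ1 := one_le_norm_intCast hQ
  have hlast : |(Q (Fin.last m) : ℝ)| ≤ ‖(fun i => (Q i : ℝ) : Fin (m + 1) → ℝ)‖ :=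
    norm_le_pi_norm (fun i => (Q i : ℝ) : Fin (m + 1) → ℝ) (Fin.last m)
  set B := ‖(fun i => (Q i : ℝ) : Fin (m + 1) → ℝ)‖
  set q := Q (Fin.last m)
  obtain ⟨c, hc⟩ : ∃ c : Fin m → ℝ, c = fun i => a i.succ * q + Q i.castSucc := ⟨_, rfl⟩
  have hδ0 : 0 ≤ B ^ (-v) := by positivity
  have hδ1 : B ^ (-v) ≤ 1 := Real.rpow_le_one_of_one_le_of_nonpos hQ1 (by linarith)
  have hdist : ∀ p : ℤ, distInt a q ≤ max |a 0 * q + p| ‖c‖ := by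
    intro p
    refine (distInt_le a q (Fin.cons p fun i => Q i.castSucc)).trans ?_
    refine (pi_norm_le_iff_of_nonneg (by positivity)).mpr fun j => ?_
    induction j using Fin.cases with
    | zero => exact le_max_left _ _
    | succ i =>
      refine le_trans ?_ (le_max_right _ _)
      have := norm_le_pi_norm c i
      simpa [hc] using this
  have hset : {x : Fin m → ℝ | ‖x‖ ≤ R ∧ ∃ p : ℤ,
      |(∑ i, (Fin.snoc x (a 0 + ∑ i : Fin m, a i.succ * x i) : Fin (m + 1) → ℝ) i * (Q i : ℝ)) +
        (p : ℝ)| ≤ B ^ (-v)} =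
      {x : Fin m → ℝ | ‖x‖ ≤ R ∧ ∃ p : ℤ, |a 0 * q + p + ∑ j, c j * x j| ≤ B ^ (-v)} := by
    simp only [sum_snoc_affine, hc, q]
  rw [hset]
  have hK : 0 ≤ 2 * m * (2 * R) ^ m := by positivity
  rcases le_or_gt (1 / 2) ‖c‖ with h | h
  · have hcpos : 0 < ‖c‖ := by linarith
    refine (volume_iUnion_slab_le hm hR hδ0 hδ1 hcpos _ c fun p => le_max_right _ _).trans
      (ENNReal.ofReal_le_ofReal ?_)
    have h1 : 0 ≤ if Q = nearestVec a q then |(q : ℝ)| ^ (-v) / distInt a q else 0 := by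
      have := distInt_nonneg a q
      split_ifs <;> positivity
    calc _ = (2 * m * R * ‖c‖ + 3) / ‖c‖ * (2 * m * (2 * R) ^ m) * B ^ (-v) := by ring
      _ ≤ (2 * m * R + 6) * (2 * m * (2 * R) ^ m) * B ^ (-v) := by
          gcongr
          rw [div_le_iff₀ hcpos]
          linarith
      _ ≤ _ := by
          gcongr
          linarith
  · have hQeq := eq_nearestVec a Q (by rw [hc] at h; exact h)
    have hq : q ≠ 0 := by
      intro hq
      apply hQ
      rw [hQeq]
      change nearestVec a q = 0
      rw [hq]
      funext j
      induction j using Fin.lastCases with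
      | last => rw [nearestVec_last]; rfl
      | cast i => simp [nearestVec]
    have hd := ha q hq
    refine (volume_iUnion_slab_le hm hR hδ0 hδ1 hd _ c hdist).trans (ENNReal.ofReal_le_ofReal ?_)
    rw [if_pos hQeq]
    have hq' : 0 < |(q : ℝ)| := by simpa using hq
    have h1 : B ^ (-v) ≤ |(q : ℝ)| ^ (-v) :=
      Real.rpow_le_rpow_of_nonpos hq' hlast (by linarith)
    have h2 : 2 * m * R * ‖c‖ ≤ 2 * m * R * 1 := by
      gcongr
      linarith
    have h3 : 2 * m * R * ‖c‖ + 3 ≤ 2 * m * R + 6 := by linarith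
    calc _ ≤ (2 * m * R + 6) * (2 * m * (2 * R) ^ m * (|(q : ℝ)| ^ (-v) / distInt a q)) := by
          gcongr
      _ = (2 * m * R + 6) * (2 * m * (2 * R) ^ m) * (0 + |(q : ℝ)| ^ (-v) / distInt a q) := by
          ring
      _ ≤ _ := by gcongr

theorem ae_not_inW {m : ℕ} (hm : 1 ≤ m) (a : Fin (m + 1) → ℝ) {w v : ℝ} (hw : (m : ℝ) + 1 < w)
    (hwv : w < v)
    (hfin : {q : ℤ | ∃ p : Fin (m + 1) → ℤ,
        ‖(fun i => a i * (q : ℝ) + (p i : ℝ) : Fin (m + 1) → ℝ)‖ ≤ |(q : ℝ)| ^ (-w)}.Finite) :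
    ∀ᵐ x : Fin m → ℝ,
      ¬ InW (Fin.snoc x (a 0 + ∑ i : Fin m, a i.succ * x i) : Fin (m + 1) → ℝ) v := by
  obtain ⟨c, hc, hca⟩ := exists_pos_le_distInt_mul_rpow a hfin
  have hm0 : (0 : ℝ) ≤ m := by positivity
  have ha : ∀ q : ℤ, q ≠ 0 → 0 < distInt a q := by
    intro q hq
    by_contra h
    have h0 : distInt a q = 0 := le_antisymm (not_lt.mp h) (distInt_nonneg a q)
    have := hca q hq
    rw [h0] at this
    linarith
  have hR : ∀ k : ℕ, ∀ᵐ x : Fin m → ℝ, ‖x‖ ≤ (k : ℝ) + 1 →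
      ¬ InW (Fin.snoc x (a 0 + ∑ i : Fin m, a i.succ * x i) : Fin (m + 1) → ℝ) v := by
    intro k
    let s : (Fin (m + 1) → ℤ) → Set (Fin m → ℝ) := fun Q => {x | Q ≠ 0 ∧ ‖x‖ ≤ (k : ℝ) + 1 ∧
      ∃ p : ℤ,
      |(∑ i, (Fin.snoc x (a 0 + ∑ i : Fin m, a i.succ * x i) : Fin (m + 1) → ℝ) i * (Q i : ℝ)) +
        (p : ℝ)| ≤ ‖(fun i => (Q i : ℝ) : Fin (m + 1) → ℝ)‖ ^ (-v)}
    let f : (Fin (m + 1) → ℤ) → ℝ := fun Q =>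
      (2 * m * ((k : ℝ) + 1) + 6) * (2 * m * (2 * ((k : ℝ) + 1)) ^ m) *
        (‖(fun i => (Q i : ℝ) : Fin (m + 1) → ℝ)‖ ^ (-v) +
          if Q = nearestVec a (Q (Fin.last m)) then
            |(Q (Fin.last m) : ℝ)| ^ (-v) / distInt a (Q (Fin.last m)) else 0)
    have hf : Summable f := by
      refine ((summable_norm_intCast_rpow_neg (by push_cast; linarith)).add ?_).mul_left _
      have hinj : Function.Injective (nearestVec a) := fun q q' h => by
        rw [← nearestVec_last a q, h, nearestVec_last]
      rw [← hinj.summable_iff]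
      · refine (summable_rpow_neg_div_distInt a hc (by linarith) hwv hca).congr fun q => ?_
        simp [nearestVec_last]
      · intro Q hQ
        exact if_neg fun h => hQ ⟨_, h.symm⟩
    have hs : ∀ Q, volume (s Q) ≤ ENNReal.ofReal (f Q) := by
      intro Q
      by_cases hQ : Q = 0
      · have : s Q = ∅ := by
          ext x
          simp [s, hQ]
        rw [this]
        simp
      · refine (measure_mono fun x hx => hx.2).trans
          (volume_approx_le hm (by simp) (by linarith) a ha Q hQ)
    have hsum : ∑' Q, volume (s Q) ≠ ⊤ :=
      ne_top_of_le_ne_top hf.tsum_ofReal_ne_top (ENNReal.tsum_le_tsum hs)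
    filter_upwards [ae_finite_setOfPred_mem hsum] with x hx hxk hInW
    refine hInW ((hx.union (Set.finite_singleton 0)).subset fun Q hQ => ?_)
    by_cases h0 : Q = 0
    · exact Or.inr h0
    · exact Or.inl ⟨h0, hxk, hQ⟩
  filter_upwards [ae_all_iff.mpr hR] with x hx
  obtain ⟨k, hk⟩ := exists_nat_ge ‖x‖
  exact hx k (by linarith)

theorem InW.mono {n : ℕ} {y : Fin n → ℝ} {u v : ℝ} (huv : u ≤ v) (h : InW y v) : InW y u := by
  intro hfin
  refine h ((hfin.union (Set.finite_singleton 0)).subset fun Q hQ => ?_)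
  by_cases h0 : Q = 0
  · exact Or.inr h0
  · obtain ⟨p, hp⟩ := hQ
    exact Or.inl ⟨p, hp.trans
      (Real.rpow_le_rpow_of_exponent_le (one_le_norm_intCast h0) (by linarith))⟩

theorem isVWA_of_infinite {m : ℕ} (a : Fin (m + 1) → ℝ) {v : ℝ} (hv : (m : ℝ) + 1 < v)
    (hinf : {q : ℤ | ∃ p : Fin (m + 1) → ℤ,
        ‖(fun i => a i * (q : ℝ) + (p i : ℝ) : Fin (m + 1) → ℝ)‖ ≤ |(q : ℝ)| ^ (-v)}.Infinite)
    (x : Fin m → ℝ) :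
    IsVWA (Fin.snoc x (a 0 + ∑ i : Fin m, a i.succ * x i) : Fin (m + 1) → ℝ) := by
  obtain ⟨u, hu, huv⟩ := exists_between hv
  refine ⟨u, by push_cast; exact hu, ?_⟩
  obtain ⟨C, hC⟩ : ∃ C, C = ‖a‖ + 1 := ⟨_, rfl⟩
  have hC1 : 1 ≤ C := by rw [hC]; linarith [norm_nonneg a]
  obtain ⟨D, hD⟩ : ∃ D, D = (1 + m * ‖x‖) * C ^ u := ⟨_, rfl⟩
  have hlarge : ∃ N : ℕ, ∀ t : ℝ, (N : ℝ) < t → D ≤ t ^ (v - u) := by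
    have h := (tendsto_rpow_atTop (sub_pos.mpr huv)).eventually_ge_atTop D
    obtain ⟨N, hN⟩ := Filter.eventually_atTop.mp h
    obtain ⟨k, hk⟩ := exists_nat_ge N
    exact ⟨k, fun t ht => hN t (hk.trans ht.le)⟩
  obtain ⟨N, hN⟩ := hlarge
  have hinf' := hinf.sdiff (Set.finite_Icc (-(N : ℤ)) N)
  have hex : ∀ q : ℤ, ∃ p : Fin (m + 1) → ℤ, q ∈ {q : ℤ | ∃ p : Fin (m + 1) → ℤ,
        ‖(fun i => a i * (q : ℝ) + (p i : ℝ) : Fin (m + 1) → ℝ)‖ ≤ |(q : ℝ)| ^ (-v)} →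
        ‖(fun i => a i * (q : ℝ) + (p i : ℝ) : Fin (m + 1) → ℝ)‖ ≤ |(q : ℝ)| ^ (-v) := by
    intro q
    by_cases h : q ∈ {q : ℤ | ∃ p : Fin (m + 1) → ℤ,
        ‖(fun i => a i * (q : ℝ) + (p i : ℝ) : Fin (m + 1) → ℝ)‖ ≤ |(q : ℝ)| ^ (-v)}
    · obtain ⟨p, hp⟩ := h
      exact ⟨p, fun _ => hp⟩
    · exact ⟨0, fun h' => absurd h' h⟩
  choose P hP using hex
  let F : ℤ → Fin (m + 1) → ℤ := fun q => Fin.snoc (fun i : Fin m => P q i.succ) q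
  have hFlast : ∀ q, F q (Fin.last m) = q := fun q => by simp [F]
  have hFcast : ∀ q (i : Fin m), F q i.castSucc = P q i.succ := fun q i => by simp [F]
  refine Set.infinite_of_injOn_mapsTo (f := F) (fun q _ q' _ h => ?_) (fun q hq => ?_) hinf'
  · rw [← hFlast q, h, hFlast]
  · obtain ⟨hq1, hq2⟩ := hq
    have hp := hP q hq1
    have hqN : (N : ℝ) < |(q : ℝ)| := by
      have : (N : ℤ) < |q| := by
        by_contra hcon
        exact hq2 (Set.mem_Icc.mpr (abs_le.mp (not_lt.mp hcon)))
      exact_mod_cast this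
    have hq1' : 1 ≤ |(q : ℝ)| := by
      have h0 : q ≠ 0 := by
        rintro rfl
        simp at hqN
        linarith [(Nat.cast_nonneg N : (0 : ℝ) ≤ N)]
      exact_mod_cast Int.one_le_abs h0
    set t := |(q : ℝ)|
    have ht0 : 0 < t := by linarith
    have htv : t ^ (-v) ≤ 1 := Real.rpow_le_one_of_one_le_of_nonpos hq1' (by linarith)
    have hcoord : ∀ i, |a i * (q : ℝ) + (P q i : ℝ)| ≤ t ^ (-v) := fun i =>
      (norm_le_pi_norm (fun i => a i * (q : ℝ) + (P q i : ℝ)) i).trans hp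
    have hnorm : ‖(fun i => (F q i : ℝ) : Fin (m + 1) → ℝ)‖ ≤ C * t := by
      refine (pi_norm_le_iff_of_nonneg (by positivity)).mpr fun j => ?_
      induction j using Fin.lastCases with
      | last =>
        rw [hFlast]
        exact le_mul_of_one_le_left ht0.le hC1
      | cast i =>
        rw [hFcast, Real.norm_eq_abs]
        have h1 := abs_sub (a i.succ * (q : ℝ) + (P q i.succ : ℝ)) (a i.succ * (q : ℝ))
        rw [add_sub_cancel_left, abs_mul] at h1
        have h2 : |a i.succ| * t ≤ ‖a‖ * t := by
          gcongr
          exact norm_le_pi_norm a i.succ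
        have h3 := hcoord i.succ
        rw [hC]
        change _ ≤ _ + |a i.succ| * t at h1
        linarith
    have hFpos : 0 < ‖(fun i => (F q i : ℝ) : Fin (m + 1) → ℝ)‖ := by
      have h1 := norm_le_pi_norm (fun i => (F q i : ℝ) : Fin (m + 1) → ℝ) (Fin.last m)
      simp only [hFlast] at h1
      exact ht0.trans_le h1
    refine ⟨P q 0, ?_⟩
    rw [sum_snoc_affine, hFlast]
    simp only [hFcast]
    have hsum := abs_sum_mul_le (fun i : Fin m => a i.succ * (q : ℝ) + (P q i.succ : ℝ)) x
    have hcn : ‖(fun i : Fin m => a i.succ * (q : ℝ) + (P q i.succ : ℝ))‖ ≤ t ^ (-v) :=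
      (pi_norm_le_iff_of_nonneg (by positivity)).mpr fun i => hcoord i.succ
    calc _ ≤ t ^ (-v) + m * t ^ (-v) * ‖x‖ := by
          refine (abs_add_le _ _).trans (add_le_add (hcoord 0) (hsum.trans ?_))
          gcongr
      _ = D * C ^ (-u) * t ^ (-v) := by
          rw [hD, mul_assoc (1 + m * ‖x‖), ← Real.rpow_add (by linarith), add_neg_cancel,
            Real.rpow_zero]
          ring
      _ ≤ t ^ (v - u) * C ^ (-u) * t ^ (-v) := by
          gcongr
          exact hN t hqN
      _ = (C * t) ^ (-u) := by
          rw [Real.mul_rpow (by linarith) ht0.le, mul_right_comm, ← Real.rpow_add ht0, mul_comm]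
          congr 2
          ring
      _ ≤ _ := Real.rpow_le_rpow_of_nonpos hFpos hnorm (by linarith)

/-- **Theorem 1.3, case (1.5)** (affine hyperplanes; here `n = m + 1 ≥ 2`).
The affine hyperplane of `ℝ^n` parametrized by
`x = (x_1,…,x_{n-1}) ↦ (x_1,…,x_{n-1}, a_0 + a_1 x_1 + … + a_{n-1} x_{n-1})`
is extremal if and only if `a ∉ W_n^+(n,1)`, i.e. iff for every `v > n` there are only
finitely many `q ∈ ℤ` with `‖aq + p‖ ≤ |q|^{-v}` for some `p ∈ ℤ^n`. -/
theorem hyperplane_extremal_iff (m : ℕ) (hm : 1 ≤ m) (a : Fin (m + 1) → ℝ) :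
    IsExtremal (Set.univ : Set (Fin m → ℝ))
      (fun x => Fin.snoc x (a 0 + ∑ i : Fin m, a i.succ * x i)) ↔
    ∀ v : ℝ, ((m : ℝ) + 1) < v →
      {q : ℤ | ∃ p : Fin (m + 1) → ℤ,
        ‖(fun i => a i * (q : ℝ) + (p i : ℝ) : Fin (m + 1) → ℝ)‖ ≤ |(q : ℝ)| ^ (-v)}.Finite := by
  constructor
  · intro hext v hv
    by_contra hinf
    have huniv : {x ∈ (Set.univ : Set (Fin m → ℝ)) |
        IsVWA (Fin.snoc x (a 0 + ∑ i : Fin m, a i.succ * x i) : Fin (m + 1) → ℝ)} = Set.univ :=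
      Set.eq_univ_of_forall fun x => ⟨trivial, isVWA_of_infinite a hv hinf x⟩
    rw [IsExtremal, huniv] at hext
    exact (isOpen_univ.measure_pos volume Set.univ_nonempty).ne' hext
  · intro hfin
    have hk : ∀ k : ℕ, ∀ᵐ x : Fin m → ℝ, ¬ InW
        (Fin.snoc x (a 0 + ∑ i : Fin m, a i.succ * x i) : Fin (m + 1) → ℝ)
        ((m : ℝ) + 1 + 1 / ((k : ℝ) + 1)) := by
      intro k
      have hpos : 0 < 1 / ((k : ℝ) + 1) := by positivity
      exact ae_not_inW hm a (w := (m : ℝ) + 1 + 1 / ((k : ℝ) + 1) / 2) (by linarith)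
        (by linarith) (hfin _ (by linarith))
    have hae : ∀ᵐ x : Fin m → ℝ,
        ¬ IsVWA (Fin.snoc x (a 0 + ∑ i : Fin m, a i.succ * x i) : Fin (m + 1) → ℝ) := by
      filter_upwards [ae_all_iff.mpr hk] with x hx
      rintro ⟨v, hv, hIn⟩
      push_cast at hv
      obtain ⟨k, hk⟩ := exists_nat_one_div_lt (sub_pos.mpr hv)
      exact hx k (hIn.mono (by linarith))
    rw [ae_iff] at hae
    simpa [IsExtremal] using hae
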